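/- Let a : ℝ → ℝ³ be differentiable at τ. Then lim_{h→0} (2(1 − e^{-|a(τ+h) − a(τ)|²/2}))/h² = |a'(τ)|². (Since 2(1 − e^{-|a−b|²/2}) is, up to the overall normalization (1/√(2π))³, the squared H-distance ‖δ³_a − δ³_b‖²_H between the delta functions at a and b, this shows that the metric induced on the submanifold of delta functions is the Euclidean metric of ℝ³, i.e., the embedding a ↦ δ³_a is isometric.) -/

import Mathlib

open MeasureTheory Real Filter

/-- If `a : ℝ → ℝ³` is differentiable at `τ`, then
`lim_{h→0} 2(1 − e^{-|a(τ+h) − a(τ)|²/2})/h² = |a'(τ)|²`: the metric induced on the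
submanifold of delta functions by the Gaussian-kernel inner product is the Euclidean
metric of `ℝ³`, i.e. the embedding `a ↦ δ³ₐ` is isometric. -/
theorem induced_metric_is_euclidean
    (a : ℝ → EuclideanSpace ℝ (Fin 3)) (τ : ℝ) (a' : EuclideanSpace ℝ (Fin 3))
    (ha : HasDerivAt a a' τ) :
    Tendsto (fun h : ℝ =>
        2 * (1 - Real.exp (-‖a (τ + h) - a τ‖ ^ 2 / 2)) / h ^ 2)
      (nhdsWithin 0 {(0 : ℝ)}ᶜ) (nhds (‖a'‖ ^ 2)) := by
  have h1 := (hasDerivAt_iff_tendsto_slope_zero.1 ha).norm.pow 2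
  let g : ℝ → ℝ := fun x => 2 * (1 - Real.exp (-x / 2))
  have hg : HasDerivAt g 1 0 := by
    have h := ((((hasDerivAt_id (0 : ℝ)).neg.div_const 2).exp.const_sub 1).const_mul 2)
    exact HasDerivAt.congr_deriv (f := g) h (by simp; norm_num)
  have hd : ContinuousAt (dslope g 0) 0 := continuousAt_dslope_same.2 hg.differentiableAt
  have hd0 : dslope g 0 0 = 1 := by rw [dslope_same, hg.deriv]
  have hs : Tendsto (fun h : ℝ => ‖a (τ + h) - a τ‖ ^ 2) (nhdsWithin 0 {(0 : ℝ)}ᶜ) (nhds 0) := by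
    have hc : ContinuousAt (fun h : ℝ => ‖a (τ + h) - a τ‖ ^ 2) 0 := by
      have hc1 : ContinuousAt (fun h : ℝ => a (τ + h)) 0 := by
        apply ContinuousAt.comp (g := a) (f := fun h : ℝ => τ + h)
        · simpa using ha.continuousAt
        · fun_prop
      exact ((hc1.sub continuousAt_const).norm).pow 2
    have := hc.tendsto.mono_left (nhdsWithin_le_nhds (s := {(0 : ℝ)}ᶜ))
    simpa using this
  have h2 := h1.mul (hd.tendsto.comp hs)
  rw [hd0, mul_one] at h2
  refine h2.congr fun h => ?_
  have key := sub_smul_dslope g 0 (‖a (τ + h) - a τ‖ ^ 2)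
  have g0 : g 0 = 0 := by simp [g]
  rw [g0, sub_zero, sub_zero, smul_eq_mul] at key
  change _ = g (‖a (τ + h) - a τ‖ ^ 2) / h ^ 2
  rw [← key, norm_smul, mul_pow, norm_inv, inv_pow, Real.norm_eq_abs, sq_abs]
  simp only [Function.comp]
  ring
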